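/- Let P_n(x) be defined by P_0(x) = 1 and P_n(x) = (x/n) Σ_{k=1}^{n} σ(k) P_{n-k}(x). Then for all real x ≥ 0, n ≥ 1, and every positive integer m, P_n(x) ≥ Σ_{k=1}^{m} C(n-1, k-1) · x^k / k!. -/

import Mathlib

/-- Sum of divisors function. -/
def mysigma (n : ℕ) : ℕ := ∑ d ∈ n.divisors, d

/-- Partition function: number of partitions of `n`. -/
def partcount (n : ℕ) : ℕ := Fintype.card (Nat.Partition n)

/-- D'Arcais polynomials as real functions. -/
noncomputable def P : ℕ → ℝ → ℝ
  | 0 => fun _ => 1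
  | n + 1 => fun x => x / (n + 1) * ∑ k ∈ Finset.range (n + 1), (mysigma (k + 1) : ℝ) * P (n - k) x

/-- Number of k-colored partitions of n (each part in one of k colors),
counted via splitting into one ordinary partition per color. -/
def pcolored : ℕ → ℕ → ℕ
  | 0, n => if n = 0 then 1 else 0
  | k + 1, n => ∑ j ∈ Finset.range (n + 1), pcolored k j * partcount (n - j)

/-- Number of compositions of `n` into `j` positive parts. -/
def compositionCount : ℕ → ℕ → ℕ
  | 0, 0 => 1
  | 0, _ + 1 => 0
  | _ + 1, 0 => 0
  | n + 1, j + 1 => n.choose j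

theorem compositionCount_succ_zero (n : ℕ) : compositionCount (n + 1) 0 = 0 := rfl

theorem compositionCount_succ_succ (n j : ℕ) :
    compositionCount (n + 1) (j + 1) = n.choose j := rfl

theorem sum_compositionCount (n j : ℕ) :
    ∑ i ∈ Finset.range (n + 1), compositionCount i j = n.choose j := by
  induction n with
  | zero => cases j <;> simp [compositionCount]
  | succ n ih =>
    rw [Finset.sum_range_succ, ih]
    cases j with
    | zero => simp [compositionCount]
    | succ j => rw [compositionCount, Nat.choose_succ_succ, add_comm]

theorem sum_mul_compositionCount (n j : ℕ) :
    ∑ k ∈ Finset.range (n + 1), (k + 1) * compositionCount (n - k) j =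
      (n + 1).choose (j + 1) := by
  induction n with
  | zero => cases j <;> simp [compositionCount, Nat.choose_eq_zero_of_lt]
  | succ n ih =>
    have hs : ∑ k ∈ Finset.range (n + 2), compositionCount (n + 1 - k) j =
        (n + 1).choose j := by
      rw [← sum_compositionCount]
      exact Finset.sum_range_reflect (fun i => compositionCount i j) (n + 2)
    have hk : ∑ k ∈ Finset.range (n + 2), k * compositionCount (n + 1 - k) j =
        (n + 1).choose (j + 1) := by
      rw [Finset.sum_range_succ', ← ih]
      simp
    simp only [add_mul, one_mul, Finset.sum_add_distrib, hs, hk]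
    rw [Nat.choose_succ_succ (n + 1) j, add_comm]

theorem le_mysigma {n : ℕ} (hn : n ≠ 0) : n ≤ mysigma n :=
  Finset.single_le_sum (f := fun d => d) (fun _ _ => Nat.zero_le _)
    (Nat.mem_divisors_self n hn)

theorem sum_compositionCount_mul_pow_succ (x : ℝ) (n M : ℕ) :
    ∑ j ∈ Finset.range (M + 1), (compositionCount (n + 1) j : ℝ) * x ^ j / j.factorial =
      x / (n + 1) * ∑ k ∈ Finset.range (n + 1), ((k + 1 : ℕ) : ℝ) *
        ∑ j ∈ Finset.range M, (compositionCount (n - k) j : ℝ) * x ^ j / j.factorial := by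
  simp_rw [Finset.mul_sum]
  rw [Finset.sum_comm, Finset.sum_range_succ']
  simp only [compositionCount_succ_zero, compositionCount_succ_succ, Nat.cast_zero, zero_mul, zero_div, add_zero]
  refine Finset.sum_congr rfl fun j _ => ?_
  have h : ((n : ℝ) + 1) * n.choose j = (n + 1).choose (j + 1) * ((j : ℝ) + 1) := by
    exact_mod_cast Nat.add_one_mul_choose_eq n j
  have hs : ∑ k ∈ Finset.range (n + 1), ((k + 1 : ℕ) : ℝ) * (compositionCount (n - k) j : ℝ) =
      (n + 1).choose (j + 1) := by
    exact_mod_cast sum_mul_compositionCount n j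
  calc (n.choose j : ℝ) * x ^ (j + 1) / (j + 1).factorial
      = x / (n + 1) * (((n + 1).choose (j + 1) : ℝ) * (x ^ j / j.factorial)) := by
        have hj : (j.factorial : ℝ) ≠ 0 := by positivity
        rw [Nat.factorial_succ]
        push_cast
        field_simp
        linear_combination x ^ (j + 1) * h
    _ = _ := by
        rw [← hs, Finset.sum_mul, Finset.mul_sum]
        exact Finset.sum_congr rfl fun k _ => by ring

theorem sum_compositionCount_mul_pow_le_P {x : ℝ} (hx : 0 ≤ x) (n M : ℕ) :
    ∑ j ∈ Finset.range M, (compositionCount n j : ℝ) * x ^ j / j.factorial ≤ P n x := by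
  induction n using Nat.strong_induction_on generalizing M with
  | _ n ih =>
    refine (Finset.sum_le_sum_of_subset_of_nonneg
      (Finset.range_mono (Nat.le_succ M)) fun j _ _ => by positivity).trans ?_
    cases n with
    | zero =>
      rw [Finset.sum_range_succ']
      simp [compositionCount, P]
    | succ n =>
      rw [Nat.succ_eq_add_one, sum_compositionCount_mul_pow_succ, P]
      refine mul_le_mul_of_nonneg_left (Finset.sum_le_sum fun k _ => ?_) (by positivity)
      exact mul_le_mul (Nat.cast_le.2 (le_mysigma k.succ_ne_zero)) (ih _ (by omega) M)
        (Finset.sum_nonneg fun j _ => by positivity) (Nat.cast_nonneg _)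

theorem darcais_lower_bound (x : ℝ) (hx : 0 ≤ x) (n : ℕ) (hn : 1 ≤ n) (m : ℕ) (hm : 0 < m) :
    P n x ≥ ∑ k ∈ Finset.Icc 1 m, (Nat.choose (n - 1) (k - 1) : ℝ) * x ^ k / (Nat.factorial k : ℝ) := by
  obtain ⟨n, rfl⟩ := Nat.exists_eq_add_of_le' hn
  refine le_trans (le_of_eq ?_) (sum_compositionCount_mul_pow_le_P hx (n + 1) (m + 1))
  rw [Finset.sum_range_succ', ← Finset.Ico_add_one_right_eq_Icc, Finset.sum_Ico_eq_sum_range]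
  simp [compositionCount, add_comm 1]
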